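/- Let g : ℝ² → ℝ be continuously differentiable, let x₀ ∈ ℝ² satisfy g(x₀) = 0 and ∇g(x₀) ≠ 0, and let h : ℝ² → ℝ be continuous. Then for every ε > 0 there exists λ₀ > 0 such that for every real λ with |λ| < λ₀ there exists y ∈ ℝ² with ‖y − x₀‖ < ε and g(y) + λ h(y) = 0. -/

import Mathlib

/-- A function with nonzero derivative at `x` takes values below `g x` in every ball around `x`. -/
theorem exists_mem_ball_lt_of_fderiv_ne_zero {E : Type*} [NormedAddCommGroup E] [NormedSpace ℝ E]
    {g : E → ℝ} {x : E} (hx : fderiv ℝ g x ≠ 0) {ε : ℝ} (hε : 0 < ε) :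
    ∃ a ∈ Metric.ball x ε, g a < g x := by
  by_contra! H
  have hmin : IsLocalMin g x := Filter.eventually_of_mem (Metric.ball_mem_nhds x hε) H
  exact hx hmin.fderiv_eq_zero

/-- A function with nonzero derivative at `x` takes values above `g x` in every ball around `x`. -/
theorem exists_mem_ball_gt_of_fderiv_ne_zero {E : Type*} [NormedAddCommGroup E] [NormedSpace ℝ E]
    {g : E → ℝ} {x : E} (hx : fderiv ℝ g x ≠ 0) {ε : ℝ} (hε : 0 < ε) :
    ∃ b ∈ Metric.ball x ε, g x < g b := by
  by_contra! H
  have hmax : IsLocalMax g x := Filter.eventually_of_mem (Metric.ball_mem_nhds x hε) H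
  exact hx hmax.fderiv_eq_zero

/-- Near a nondegenerate zero `x₀` of `g`, the perturbed function `g + λ h` still has a
zero within distance `ε` of `x₀`, for all sufficiently small `λ`. -/
theorem stmt_7 (g : EuclideanSpace ℝ (Fin 2) → ℝ) (hg : ContDiff ℝ 1 g)
    (x0 : EuclideanSpace ℝ (Fin 2)) (hx0 : g x0 = 0)
    (hgrad : gradient g x0 ≠ 0)
    (h : EuclideanSpace ℝ (Fin 2) → ℝ) (hh : Continuous h) :
    ∀ ε > 0, ∃ lam0 > 0, ∀ lam : ℝ, |lam| < lam0 →
      ∃ y : EuclideanSpace ℝ (Fin 2), ‖y - x0‖ < ε ∧ g y + lam * h y = 0 := by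
  intro ε hε
  have hderiv : fderiv ℝ g x0 ≠ 0 := fun H => hgrad (by simp [gradient, H])
  obtain ⟨a, ha, hga⟩ := exists_mem_ball_lt_of_fderiv_ne_zero hderiv hε
  obtain ⟨b, hb, hgb⟩ := exists_mem_ball_gt_of_fderiv_ne_zero hderiv hε
  rw [hx0] at hga hgb
  have hcont (y : EuclideanSpace ℝ (Fin 2)) :
      ContinuousAt (fun lam : ℝ => g y + lam * h y) 0 := by fun_prop
  have hneg : ∀ᶠ lam in nhds (0 : ℝ), g a + lam * h a < 0 :=
    (hcont a).eventually_lt_const (by simpa using hga)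
  have hpos : ∀ᶠ lam in nhds (0 : ℝ), 0 < g b + lam * h b :=
    (hcont b).eventually_const_lt (by simpa using hgb)
  obtain ⟨lam0, hlam0, hball⟩ := Metric.eventually_nhds_iff.1 (hneg.and hpos)
  refine ⟨lam0, hlam0, fun lam hlam => ?_⟩
  obtain ⟨hla, hlb⟩ := hball (by simpa [Real.dist_eq] using hlam)
  have hgc : Continuous g := hg.continuous
  have hsum : Continuous fun y => g y + lam * h y := by fun_prop
  obtain ⟨y, hy, hzero⟩ := (convex_ball x0 ε).isPreconnected.intermediate_value ha hb
    hsum.continuousOn ⟨hla.le, hlb.le⟩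
  exact ⟨y, mem_ball_iff_norm.1 hy, hzero⟩
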